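/- Let a ≥ 1, b ≥ 0, set L = U^a ⊕ E8(−1)^b and M = L ⊕ U, where the last summand U has basis f_1, f_2 with ⟨f_1,f_1⟩ = ⟨f_2,f_2⟩ = 0 and ⟨f_1,f_2⟩ = 1, and set e = f_2. Let R_1 be the set of δ ∈ M with ⟨δ,δ⟩ = −2 and ⟨δ,e⟩ = 1, and let Γ_3 be the subgroup of O(M) generated by: isometries of L extended by the identity on the last U summand; the Eichler transvections E_{f,λ}(α) = α + ⟨α,f⟩λ − ⟨α,λ⟩f − (⟨λ,λ⟩/2)⟨α,f⟩f for f ∈ {f_1, f_2} and λ ∈ L; and the reflections s_δ for δ ∈ R_1. If δ ∈ M satisfies ⟨δ,δ⟩ = −2 and ⟨δ,e⟩ = 0, then there exists σ ∈ Γ_3 with ⟨σ(δ), e⟩ = 1. -/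

import Mathlib

open Matrix

/-- Gram matrix of the hyperbolic plane `U`. -/
def gramU : Matrix (Fin 2) (Fin 2) ℤ := !![0, 1; 1, 0]

/-- Gram matrix of `E8(−1)`, the negative of the E₈ Cartan (Gram) matrix. -/
def gramE8neg : Matrix (Fin 8) (Fin 8) ℤ := - CartanMatrix.E₈

/-- Index type for the lattice `L = U^a ⊕ E8(−1)^b`. -/
abbrev IdxL (a b : ℕ) := (Fin 2 × Fin a) ⊕ (Fin 8 × Fin b)

/-- Gram matrix of `L = U^a ⊕ E8(−1)^b`. -/
def gramL (a b : ℕ) : Matrix (IdxL a b) (IdxL a b) ℤ :=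
  Matrix.fromBlocks (Matrix.blockDiagonal fun _ => gramU) 0 0
    (Matrix.blockDiagonal fun _ => gramE8neg)

/-- Index type for `M = L ⊕ U`; the last `U` summand has basis `f₁ = inr 0`, `f₂ = inr 1`. -/
abbrev IdxM (a b : ℕ) := IdxL a b ⊕ Fin 2

/-- Gram matrix of `M = L ⊕ U`. -/
def gramM (a b : ℕ) : Matrix (IdxM a b) (IdxM a b) ℤ :=
  Matrix.fromBlocks (gramL a b) 0 0 gramU

/-- The bilinear form on `M = L ⊕ U`. Elements `(v,m,n) = v + m f₁ + n f₂` of `M` are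
functions `IdxM a b → ℤ`, with `m = ·(Sum.inr 0)`, `n = ·(Sum.inr 1)`. -/
def bilM (a b : ℕ) (x y : IdxM a b → ℤ) : ℤ := x ⬝ᵥ (gramM a b).mulVec y

/-- The vector `e = f₂`. -/
def eVec (a b : ℕ) : IdxM a b → ℤ := Pi.single (Sum.inr 1) 1

/-- The bilinear form on `L = U^a ⊕ E8(−1)^b`. -/
def bilL (a b : ℕ) (x y : IdxL a b → ℤ) : ℤ := x ⬝ᵥ (gramL a b).mulVec y

/-- The basis vector `f₁` of the last `U` summand. -/
def fOne (a b : ℕ) : IdxM a b → ℤ := Pi.single (Sum.inr 0) 1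

/-- The basis vector `f₂` of the last `U` summand (also `e = f₂`). -/
def fTwo (a b : ℕ) : IdxM a b → ℤ := Pi.single (Sum.inr 1) 1

/-- The extension of a map of `L` to `M = L ⊕ U` acting as the identity on `U`. -/
def extendL (a b : ℕ) (g : (IdxL a b → ℤ) → (IdxL a b → ℤ)) :
    (IdxM a b → ℤ) → (IdxM a b → ℤ) :=
  fun x => Sum.elim (g fun i => x (Sum.inl i)) (fun j => x (Sum.inr j))

/-- The generators of `Γ₃`: isometries of `L` extended by the identity on the last `U`
summand; the Eichler transvections `E_{f,λ}` for `f ∈ {f₁,f₂}` and `λ ∈ L`; and the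
reflections `s_δ` for `δ ∈ R₁` (i.e. `⟨δ,δ⟩ = −2`, `⟨δ,e⟩ = 1`). -/
def gensGamma3 (a b : ℕ) : Set ((IdxM a b → ℤ) → (IdxM a b → ℤ)) :=
  {h | ∃ g : (IdxL a b → ℤ) ≃ₗ[ℤ] (IdxL a b → ℤ),
      (∀ x y, bilL a b (g x) (g y) = bilL a b x y) ∧ h = extendL a b (⇑g)} ∪
  {h | ∃ (f lam : IdxM a b → ℤ) (c : ℤ),
      (f = fOne a b ∨ f = fTwo a b) ∧ (∀ j : Fin 2, lam (Sum.inr j) = 0) ∧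
      bilM a b lam lam = 2 * c ∧
      h = fun α => α + (bilM a b α f) • lam - (bilM a b α lam) • f
            - (c * bilM a b α f) • f} ∪
  {h | ∃ δ : IdxM a b → ℤ, bilM a b δ δ = -2 ∧ bilM a b δ (fTwo a b) = 1 ∧
      h = fun α => α + (bilM a b α δ) • δ}

/-- One step of the action of `Γ₃` (a generator or its inverse); the
reflexive-transitive closure of this relation is exactly the orbit relation of the
subgroup `Γ₃` generated by `gensGamma3`. -/
def stepGamma3 (a b : ℕ) (x y : IdxM a b → ℤ) : Prop :=
  ∃ h ∈ gensGamma3 a b, y = h x ∨ x = h y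

/-- An integral Gram matrix which is even (of the form `A + Aᵀ`) and right invertible. -/
structure IsEvenUnimodular {ι : Type*} [Fintype ι] [DecidableEq ι] (G : Matrix ι ι ℤ) : Prop where
  even : ∃ A : Matrix ι ι ℤ, G = A + Aᵀ
  inv : ∃ B : Matrix ι ι ℤ, G * B = 1

namespace IsEvenUnimodular

variable {ι κ : Type*} [Fintype ι] [DecidableEq ι] [Fintype κ] [DecidableEq κ]

lemma blockDiagonal {G : Matrix ι ι ℤ} (h : IsEvenUnimodular G) :
    IsEvenUnimodular (Matrix.blockDiagonal fun _ : κ => G) := by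
  obtain ⟨⟨A, hA⟩, B, hB⟩ := h
  refine ⟨⟨Matrix.blockDiagonal fun _ => A, ?_⟩, Matrix.blockDiagonal fun _ => B, ?_⟩
  · rw [blockDiagonal_transpose, ← blockDiagonal_add]
    exact congrArg Matrix.blockDiagonal (funext fun _ => hA)
  · rw [← blockDiagonal_mul, ← blockDiagonal_one]
    exact congrArg Matrix.blockDiagonal (funext fun _ => hB)

lemma fromBlocks {G : Matrix ι ι ℤ} {H : Matrix κ κ ℤ} (hG : IsEvenUnimodular G)
    (hH : IsEvenUnimodular H) : IsEvenUnimodular (Matrix.fromBlocks G 0 0 H) := by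
  obtain ⟨⟨A, hA⟩, B, hB⟩ := hG
  obtain ⟨⟨C, hC⟩, D, hD⟩ := hH
  refine ⟨⟨Matrix.fromBlocks A 0 0 C, ?_⟩, Matrix.fromBlocks B 0 0 D, ?_⟩
  · simp [fromBlocks_transpose, fromBlocks_add, ← hA, ← hC]
  · simp [fromBlocks_multiply, hB, hD]

lemma exists_two_mul {G : Matrix ι ι ℤ} (h : IsEvenUnimodular G) (v : ι → ℤ) :
    ∃ c, v ⬝ᵥ G *ᵥ v = 2 * c := by
  obtain ⟨⟨A, rfl⟩, -⟩ := h
  refine ⟨v ⬝ᵥ A *ᵥ v, ?_⟩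
  rw [add_mulVec, dotProduct_add, mulVec_transpose, dotProduct_comm v (v ᵥ* A),
    ← dotProduct_mulVec, two_mul]

/-- A vector of norm `-2` in an even unimodular lattice pairs to any prescribed integer
with some vector. -/
lemma exists_dotProduct_eq {G : Matrix ι ι ℤ} (h : IsEvenUnimodular G) {v : ι → ℤ}
    (hv : v ⬝ᵥ G *ᵥ v = -2) (n : ℤ) : ∃ y, v ⬝ᵥ G *ᵥ y = n := by
  let f : (ι → ℤ) →ₗ[ℤ] ℤ := (dotProductBilin ℤ ℤ v).comp G.mulVecLin
  have hf (y) : f y = v ⬝ᵥ G *ᵥ y := rfl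
  obtain ⟨d, hd⟩ := (inferInstance : (LinearMap.range f).IsPrincipal)
  have hdvd (y) : d ∣ v ⬝ᵥ G *ᵥ y := by
    have : f y ∈ Submodule.span ℤ {d} := hd ▸ LinearMap.mem_range_self f y
    obtain ⟨k, hk⟩ := Submodule.mem_span_singleton.1 this
    exact ⟨k, by rw [← hf, ← hk, smul_eq_mul, mul_comm]⟩
  have hdiv (i) : d ∣ v i := by
    obtain ⟨B, hB⟩ := h.inv
    have := hdvd (B *ᵥ Pi.single i 1)
    rwa [mulVec_mulVec, hB, one_mulVec, dotProduct_single, mul_one] at this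
  choose w hw using hdiv
  have hvw : v = d • w := funext hw
  obtain ⟨c, hc⟩ := h.exists_two_mul w
  have hunit : IsUnit d := by
    rw [hvw, mulVec_smul, smul_dotProduct, dotProduct_smul, hc, smul_eq_mul, smul_eq_mul] at hv
    exact IsUnit.of_mul_eq_one (-(d * c)) (by linarith)
  have : n ∈ LinearMap.range f := by
    rw [hd]
    obtain ⟨k, rfl⟩ : d ∣ n := hunit.dvd
    exact Submodule.mem_span_singleton.2 ⟨k, mul_comm k d⟩
  exact this

end IsEvenUnimodular

lemma isEvenUnimodular_gramU : IsEvenUnimodular gramU :=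
  ⟨⟨!![0, 1; 0, 0], by decide⟩, gramU, by decide⟩

lemma isEvenUnimodular_gramE8neg : IsEvenUnimodular gramE8neg := by
  refine ⟨⟨of fun i j => if i < j then gramE8neg i j else if i = j then -1 else 0, by decide⟩,
    -!![4, 5, 7, 10, 8, 6, 4, 2;
        5, 8, 10, 15, 12, 9, 6, 3;
        7, 10, 14, 20, 16, 12, 8, 4;
        10, 15, 20, 30, 24, 18, 12, 6;
        8, 12, 16, 24, 20, 15, 10, 5;
        6, 9, 12, 18, 15, 12, 8, 4;
        4, 6, 8, 12, 10, 8, 6, 3;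
        2, 3, 4, 6, 5, 4, 3, 2], by decide⟩

lemma isEvenUnimodular_gramL (a b : ℕ) : IsEvenUnimodular (gramL a b) :=
  isEvenUnimodular_gramU.blockDiagonal.fromBlocks isEvenUnimodular_gramE8neg.blockDiagonal

lemma bilM_sumElim (a b : ℕ) (v w : IdxL a b → ℤ) (p q : Fin 2 → ℤ) :
    bilM a b (Sum.elim v p) (Sum.elim w q) = bilL a b v w + (p 0 * q 1 + p 1 * q 0) := by
  simp [bilM, bilL, gramM, gramU, dotProduct, Fin.sum_univ_two, mulVec]

lemma fOne_eq (a b : ℕ) : fOne a b = Sum.elim (0 : IdxL a b → ℤ) ![1, 0] := by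
  ext (i | j)
  · simp [fOne]
  · fin_cases j <;> simp [fOne]

lemma fTwo_eq (a b : ℕ) : fTwo a b = Sum.elim (0 : IdxL a b → ℤ) ![0, 1] := by
  ext (i | j)
  · simp [fTwo]
  · fin_cases j <;> simp [fTwo]

lemma bilL_zero_right (a b : ℕ) (v : IdxL a b → ℤ) : bilL a b v 0 = 0 := by
  simp [bilL]

/-- The Eichler transvection `E_{f,λ}` is a step of `Γ₃`. -/
lemma stepGamma3_transvection (a b : ℕ) {f : IdxM a b → ℤ} (hf : f = fOne a b ∨ f = fTwo a b)
    {l : IdxL a b → ℤ} {c : ℤ} (hc : bilL a b l l = 2 * c) (α : IdxM a b → ℤ) :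
    stepGamma3 a b α (α + bilM a b α f • Sum.elim l 0 - bilM a b α (Sum.elim l 0) • f
      - (c * bilM a b α f) • f) := by
  refine ⟨_, Or.inl (Or.inr ⟨f, Sum.elim l 0, c, hf, fun _ => rfl, ?_, rfl⟩), Or.inl rfl⟩
  simpa [bilM_sumElim] using hc

/-- if `⟨δ,δ⟩ = −2` and `⟨δ,e⟩ = 0` (`e = f₂`), then some `σ ∈ Γ₃`
satisfies `⟨σ(δ),e⟩ = 1`. -/
theorem statement12 (a b : ℕ) (ha : 1 ≤ a) (δ : IdxM a b → ℤ)
    (h2 : bilM a b δ δ = -2) (h0 : bilM a b δ (fTwo a b) = 0) :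
    ∃ δ' : IdxM a b → ℤ, Relation.ReflTransGen (stepGamma3 a b) δ δ' ∧
      bilM a b δ' (fTwo a b) = 1 := by
  obtain ⟨v, p, rfl⟩ : ∃ v p, δ = Sum.elim v p :=
    ⟨δ ∘ Sum.inl, δ ∘ Sum.inr, (Sum.elim_comp_inl_inr δ).symm⟩
  have hp : p 0 = 0 := by simpa [fTwo_eq, bilM_sumElim, bilL_zero_right] using h0
  have hv : bilL a b v v = -2 := by simpa [bilM_sumElim, hp] using h2
  have hL := isEvenUnimodular_gramL a b
  obtain ⟨l, hl⟩ : ∃ l, bilL a b v l = p 1 := hL.exists_dotProduct_eq hv _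
  obtain ⟨μ, hμ⟩ : ∃ μ, bilL a b v μ = -1 := hL.exists_dotProduct_eq hv _
  obtain ⟨c, hc⟩ : ∃ c, bilL a b l l = 2 * c := hL.exists_two_mul l
  obtain ⟨k, hk⟩ : ∃ k, bilL a b μ μ = 2 * k := hL.exists_two_mul μ
  have step₁ : stepGamma3 a b (Sum.elim v p) (Sum.elim v 0) := by
    convert stepGamma3_transvection a b (Or.inr rfl) hc (Sum.elim v p) using 1
    rw [h0, bilM_sumElim, hl, fTwo_eq]
    ext (i | j)
    · simp
    · fin_cases j <;> simp [hp]
  have step₂ : stepGamma3 a b (Sum.elim v 0) (Sum.elim v ![1, 0]) := by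
    convert stepGamma3_transvection a b (Or.inl rfl) hk (Sum.elim v 0) using 1
    rw [fOne_eq, bilM_sumElim, bilM_sumElim, hμ, bilL_zero_right]
    ext (i | j)
    · simp
    · fin_cases j <;> simp
  exact ⟨_, .tail (.single step₁) step₂, by simp [fTwo_eq, bilM_sumElim, bilL_zero_right]⟩
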